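/- Let G be a finite group, p a prime, N a normal subgroup of G, P a Sylow p-subgroup of G, and x ∈ P. Then |N| · λ_{NP}(x) = |S_N(x)| · n_p(NP), where NP is the subgroup generated by N and P. In particular, λ_{NP}(x) does not depend on the choice of the Sylow p-subgroup P of G containing x. -/

import Mathlib

open Subgroup

/-- `H` is subnormal in `K` (as subgroups of an ambient group `G`): there is a chain
`H = H₀ ⊴ H₁ ⊴ ⋯ ⊴ Hₙ = K` with each term normal in the next. -/
def IsSubnormalIn {G : Type*} [Group G] (H K : Subgroup G) : Prop :=
  ∃ (n : ℕ) (c : Fin (n + 1) → Subgroup G), c 0 = H ∧ c (Fin.last n) = K ∧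
    ∀ i : Fin n, c i.castSucc ≤ c i.succ ∧ ((c i.castSucc).subgroupOf (c i.succ)).Normal

/-- `S_N(x)` for a subgroup `N`: the set of `g ∈ N` with `⟨x⟩` subnormal in `⟨x, g⟩`. -/
def subnormalizerSetIn {G : Type*} [Group G] (N : Subgroup G) (x : G) : Set G :=
  {g : G | g ∈ N ∧ IsSubnormalIn (zpowers x) (zpowers x ⊔ zpowers g)}


theorem exists_moebius {α : Type*} [Lattice α] [Fintype α] [DecidableEq α] [DecidableLE α] (h : α) :
    ∃ μ : α → ℤ, μ h = 1 ∧
      ∀ r, h < r → ∑ k ∈ Finset.univ.filter (fun k => h ≤ k ∧ k ≤ r), μ k = 0 := by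
  classical
  letI : LocallyFiniteOrder α := Fintype.toLocallyFiniteOrder
  refine ⟨fun k => IncidenceAlgebra.mu ℤ h k, by simp, fun r hr => ?_⟩
  have := IncidenceAlgebra.sum_Icc_mu_right (𝕜 := ℤ) h r
  rw [if_neg hr.ne] at this
  rw [← this]
  refine Finset.sum_congr ?_ fun _ _ => rfl
  ext k; simp

theorem weisner_aux {α : Type*} [Lattice α] [Fintype α] [DecidableEq α] [DecidableLE α] (h : α)
    (μ : α → ℤ)
    (hμ : ∀ r, h < r → ∑ k ∈ Finset.univ.filter (fun k => h ≤ k ∧ k ≤ r), μ k = 0)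
    (r : α) (hr : h < r) (L : α) : r ≤ L →
    ∑ k ∈ Finset.univ.filter (fun k => h ≤ k ∧ k ⊔ r = L), μ k = 0 := by
  induction L using WellFoundedLT.induction with
  | ind L ih =>
  intro hrL
  have h0 := hμ L (hr.trans_le hrL)
  have hmap : ∀ k ∈ Finset.univ.filter (fun k => h ≤ k ∧ k ≤ L),
      k ⊔ r ∈ Finset.univ.filter (fun M => r ≤ M ∧ M ≤ L) := by
    intro k hk
    simp only [Finset.mem_filter, Finset.mem_univ, true_and] at hk ⊢
    exact ⟨le_sup_right, sup_le hk.2 hrL⟩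
  rw [← Finset.sum_fiberwise_of_maps_to hmap, Finset.sum_eq_single L] at h0
  · rw [← h0]
    refine Finset.sum_congr ?_ fun _ _ => rfl
    ext k
    simp only [Finset.mem_filter, Finset.mem_univ, true_and]
    constructor
    · rintro ⟨h1, h2⟩
      exact ⟨⟨h1, h2 ▸ le_sup_left⟩, h2⟩
    · rintro ⟨⟨h1, _⟩, h2⟩
      exact ⟨h1, h2⟩
  · intro M hM hne
    simp only [Finset.mem_filter, Finset.mem_univ, true_and] at hM
    rw [← ih M (lt_of_le_of_ne hM.2 hne) hM.1]
    refine Finset.sum_congr ?_ fun _ _ => rfl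
    ext k
    simp only [Finset.mem_filter, Finset.mem_univ, true_and]
    constructor
    · rintro ⟨⟨h1, _⟩, h2⟩
      exact ⟨h1, h2⟩
    · rintro ⟨h1, h2⟩
      exact ⟨⟨h1, le_trans (h2 ▸ le_sup_left) hM.2⟩, h2⟩
  · intro hn
    simp [hrL] at hn

theorem weisner {α : Type*} [Lattice α] [Fintype α] [DecidableEq α] [DecidableLE α] (h : α)
    (μ : α → ℤ)
    (hμ : ∀ r, h < r → ∑ k ∈ Finset.univ.filter (fun k => h ≤ k ∧ k ≤ r), μ k = 0)
    (r : α) (hr : h < r) (T : Finset α) (hT : ∀ k ∈ T, h ≤ k)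
    (hd : ∀ k l, h ≤ k → k ≤ l → l ∈ T → k ∈ T)
    (hs : ∀ k ∈ T, k ⊔ r ∈ T) : ∑ k ∈ T, μ k = 0 := by
  have hmap : ∀ k ∈ T, k ⊔ r ∈ T.filter (fun M => r ≤ M) := by
    intro k hk
    simp only [Finset.mem_filter]
    exact ⟨hs k hk, le_sup_right⟩
  rw [← Finset.sum_fiberwise_of_maps_to hmap]
  refine Finset.sum_eq_zero fun M hM => ?_
  simp only [Finset.mem_filter] at hM
  rw [← weisner_aux h μ hμ r hr M hM.2]
  refine Finset.sum_congr ?_ fun _ _ => rfl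
  ext k
  simp only [Finset.mem_filter, Finset.mem_univ, true_and]
  constructor
  · rintro ⟨h1, h2⟩
    exact ⟨hT k h1, h2⟩
  · rintro ⟨h1, h2⟩
    exact ⟨hd k M h1 (h2 ▸ le_sup_left) hM.1, h2⟩

theorem sum_card_swap {α A : Type*} [Finite A] (I : Finset α) (μ : α → ℤ) (r : A → α → Prop)
    [∀ a, DecidablePred (r a)]
    (h : ∀ a, ∑ k ∈ I.filter (r a), μ k = 0) :
    ∑ k ∈ I, μ k * (Nat.card {a // r a k} : ℤ) = 0 := by
  classical
  haveI := Fintype.ofFinite A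
  have : ∀ k, (Nat.card {a // r a k} : ℤ) = ∑ a : A, if r a k then 1 else 0 := by
    intro k
    rw [Nat.card_eq_fintype_card, Fintype.card_subtype]
    simp
  simp_rw [this, Finset.mul_sum]
  rw [Finset.sum_comm]
  refine Finset.sum_eq_zero fun a _ => ?_
  have ha := h a
  rw [Finset.sum_filter] at ha
  refine Eq.trans (Finset.sum_congr rfl fun k _ => ?_) ha
  simp only [mul_ite, mul_one, mul_zero]

/-- elements of `N` normalizing some `p`-subgroup containing `H` -/
def subnSet (p : ℕ) {G : Type*} [Group G] (N H : Subgroup G) : Set G :=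
  {g | g ∈ N ∧ ∃ V : Subgroup G, IsPGroup p V ∧ H ≤ V ∧ g ∈ normalizer (V : Set G)}

theorem pgroup_lt_normalizer {p : ℕ} [Fact p.Prime] {G : Type*} [Group G] [Finite G]
    {H W : Subgroup G} (hW : IsPGroup p W) (h : H < W) : H < W ⊓ normalizer (H : Set G) := by
  haveI := hW.isNilpotent
  have hnc := Group.normalizerCondition_of_isNilpotent (G := W)
  have h1 : H.subgroupOf W < ⊤ := by
    rw [lt_top_iff_ne_top, Ne, subgroupOf_eq_top]
    exact h.not_ge
  obtain ⟨w, hw1, hw2⟩ := SetLike.exists_of_lt (hnc _ h1)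
  refine SetLike.lt_iff_le_and_exists.2 ⟨le_inf h.le le_normalizer, (w : G), Subgroup.mem_inf.2 ⟨w.2, ?_⟩, ?_⟩
  · rw [mem_normalizer_iff] at hw1 ⊢
    intro k
    constructor
    · intro hk
      have := (hw1 ⟨k, h.le hk⟩).1 (by simpa [mem_subgroupOf] using hk)
      simpa [mem_subgroupOf] using this
    · intro hk
      have hkW : k ∈ W := by
        have := W.mul_mem (W.mul_mem (W.inv_mem w.2) (h.le hk)) w.2
        simpa [mul_assoc] using this
      have := (hw1 ⟨k, hkW⟩).2 (by simpa [mem_subgroupOf] using hk)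
      simpa [mem_subgroupOf] using this
  · simpa [mem_subgroupOf] using hw2

theorem sup_sylow_eq_top {p : ℕ} [Fact p.Prime] {G : Type*} [Group G] [Finite G]
    (N : Subgroup G) [N.Normal] (hN : ∀ g : G, ∃ k : ℕ, g ^ p ^ k ∈ N) (P : Sylow p G) :
    N ⊔ (P : Subgroup G) = ⊤ := by
  have hq : IsPGroup p (G ⧸ N) := by
    intro g
    obtain ⟨g, rfl⟩ := QuotientGroup.mk_surjective g
    obtain ⟨k, hk⟩ := hN g
    exact ⟨k, by rw [← QuotientGroup.mk_pow]; exact (QuotientGroup.eq_one_iff _).2 hk⟩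
  have hP := (P.mapSurjective (QuotientGroup.mk'_surjective N)).3
    (Q := ⊤) (hq.to_subgroup ⊤) le_top
  have h2 : (P : Subgroup G).map (QuotientGroup.mk' N) = ⊤ := by
    rw [hP]; rfl
  have h3 := congrArg (Subgroup.comap (QuotientGroup.mk' N)) h2
  rw [comap_map_eq, QuotientGroup.ker_mk', comap_top] at h3
  rw [sup_comm]; exact h3

theorem case_sylow {p : ℕ} [Fact p.Prime] {G : Type*} [Group G] [Finite G]
    (N : Subgroup G) [N.Normal] (hN : ∀ g : G, ∃ k : ℕ, g ^ p ^ k ∈ N) (P : Sylow p G) :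
    Nat.card (subnSet p N P) * Nat.card (Sylow p G) =
      Nat.card N * Nat.card {Q : Sylow p G // (P : Subgroup G) ≤ Q} := by
  have h1 : Nat.card {Q : Sylow p G // (P : Subgroup G) ≤ Q} = 1 := by
    rw [Nat.card_eq_one_iff_unique]
    refine ⟨⟨fun a b => Subtype.ext (Sylow.ext ?_)⟩, ⟨⟨P, le_rfl⟩⟩⟩
    rw [P.3 a.1.2 a.2, P.3 b.1.2 b.2]
  have h2 : MulAction.orbit N P = Set.univ := by
    refine Set.eq_univ_of_forall fun Q => ?_
    obtain ⟨g, rfl⟩ := MulAction.exists_smul_eq G P Q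
    have hg : g ∈ N ⊔ (P : Subgroup G) := by rw [sup_sylow_eq_top N hN P]; trivial
    obtain ⟨n, hn, q, hq, rfl⟩ := mem_sup_of_normal_left.1 hg
    refine ⟨⟨n, hn⟩, ?_⟩
    have : q • P = P := Sylow.smul_eq_iff_mem_normalizer.2 (le_normalizer hq)
    rw [mul_smul, this]; rfl
  have h3 : Nat.card (subnSet p N P) = Nat.card (MulAction.stabilizer N P) := by
    refine Nat.card_congr ⟨fun g => ⟨⟨g.1, g.2.1⟩, ?_⟩, fun g => ⟨g.1.1, g.1.2, P, P.2, le_rfl, ?_⟩,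
      fun _ => rfl, fun _ => rfl⟩
    · obtain ⟨V, hV, hPV, hg⟩ := g.2.2
      rw [P.3 hV hPV] at hg
      exact Sylow.smul_eq_iff_mem_normalizer.2 hg
    · exact Sylow.smul_eq_iff_mem_normalizer.1 g.2
  have h4 := Nat.card_congr (MulAction.orbitProdStabilizerEquivGroup N P)
  rw [Nat.card_prod, h2, Nat.card_univ] at h4
  rw [h1, h3, mul_one, ← h4, mul_comm]

theorem mem_normalizer_subgroupOf {G : Type*} [Group G] {M V : Subgroup G} {g : M}
    (hg : (g : G) ∈ normalizer (V : Set G)) :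
    g ∈ normalizer ((V.subgroupOf M : Subgroup M) : Set M) := by
  rw [mem_normalizer_iff] at hg ⊢
  intro h
  simpa [mem_subgroupOf] using hg h

theorem mem_normalizer_map_subtype {G : Type*} [Group G] {M : Subgroup G} {V : Subgroup M} {g : M}
    (hg : g ∈ normalizer (V : Set M)) :
    (g : G) ∈ normalizer ((V.map M.subtype : Subgroup G) : Set G) := by
  rw [mem_normalizer_iff_map_conj_eq] at hg ⊢
  conv_rhs => rw [← hg]
  rw [Subgroup.map_map, Subgroup.map_map]
  rfl

theorem mem_subnSet_subgroupOf {p : ℕ} {G : Type*} [Group G] (M N K : Subgroup G)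
    (hKM : K ≤ M) (g : M) :
    g ∈ subnSet p (N.subgroupOf M) (K.subgroupOf M) ↔ (g : G) ∈ subnSet p N K := by
  constructor
  · rintro ⟨h1, V, hV, hKV, hg⟩
    refine ⟨h1, V.map M.subtype, hV.map _, ?_, mem_normalizer_map_subtype hg⟩
    have := Subgroup.map_mono (f := M.subtype) hKV
    rwa [Subgroup.map_subgroupOf_eq_of_le hKM] at this
  · rintro ⟨h1, V, hV, hKV, hg⟩
    exact ⟨h1, V.subgroupOf M, hV.comap_subtype, Subgroup.comap_mono hKV,
      mem_normalizer_subgroupOf hg⟩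

theorem sum_filter_le {p : ℕ} {G : Type*} [Group G] [Fintype (Subgroup G)] 
    [DecidableEq (Subgroup G)] [DecidableLE (Subgroup G)]
    [DecidablePred fun K : Subgroup G => IsPGroup p K] (H M : Subgroup G)
    (μ : Subgroup G → ℤ)
    (hμ : ∀ r, H < r → ∑ k ∈ Finset.univ.filter (fun k => H ≤ k ∧ k ≤ r), μ k = 0)
    (W : Subgroup G) (hW : IsPGroup p W) (hH : H ≤ W → H < W ⊓ M) 
    (r : Subgroup G → Prop) [DecidablePred r] (hr : ∀ K ≤ M, r K ↔ K ≤ W) :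
    ∑ K ∈ (Finset.univ.filter fun K : Subgroup G => IsPGroup p K ∧ H ≤ K ∧ K ≤ M).filter r,
      μ K = 0 := by
  by_cases hHW : H ≤ W
  · rw [← hμ _ (hH hHW)]
    refine Finset.sum_congr ?_ fun _ _ => rfl
    ext K
    simp only [Finset.mem_filter, Finset.mem_univ, true_and, le_inf_iff]
    constructor
    · rintro ⟨⟨h1, h2, h3⟩, h4⟩
      exact ⟨h2, (hr K h3).1 h4, h3⟩
    · rintro ⟨h1, h2, h3⟩
      exact ⟨⟨hW.to_le h2, h1, h3⟩, (hr K h3).2 h2⟩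
  · refine Finset.sum_eq_zero fun K hK => ?_
    simp only [Finset.mem_filter, Finset.mem_univ, true_and] at hK
    exact absurd (hK.1.2.1.trans ((hr K hK.1.2.2).1 hK.2)) hHW

theorem main_aux.{u} (p : ℕ) [Fact p.Prime] (n : ℕ) : ∀ (G : Type u) [Group G] [Finite G]
    (_ : Nat.card G = n) (N : Subgroup G) (_ : N.Normal) (_ : ∀ g : G, ∃ k : ℕ, g ^ p ^ k ∈ N)
    (H : Subgroup G) (_ : IsPGroup p H),
    Nat.card (subnSet p N H) * Nat.card (Sylow p G) =
      Nat.card N * Nat.card {Q : Sylow p G // H ≤ (Q : Subgroup G)} := by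
  induction n using Nat.strong_induction_on with
  | _ n IH =>
  intro G _ _ hGn N hNn hN H
  induction H using WellFoundedGT.induction with
  | ind H ih =>
  intro hH
  classical
  by_cases hHn : H.Normal
  · have h1 : subnSet p N H = (N : Set G) := by
      ext g
      refine ⟨fun h => h.1, fun h => ⟨h, H, hH, le_rfl, ?_⟩⟩
      rw [Subgroup.normalizer_eq_top]; trivial
    have h2 : Nat.card {Q : Sylow p G // H ≤ (Q : Subgroup G)} = Nat.card (Sylow p G) :=
      Nat.card_congr (Equiv.subtypeUnivEquiv fun Q => hH.le_sylow_of_normal Q)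
    rw [h1, h2]; rfl
  by_cases hHs : ∃ Q : Sylow p G, (Q : Subgroup G) = H
  · obtain ⟨Q, rfl⟩ := hHs
    exact case_sylow N hN Q
  have hfin : Finite (Subgroup G) := inferInstance
  haveI := Fintype.ofFinite (Subgroup G)
  obtain ⟨μ, hμ1, hμ⟩ := exists_moebius H
  set M : Subgroup G := normalizer (H : Set G) with hM
  have hHM : H ≤ M := le_normalizer
  have hMcard : Nat.card M < n := by
    rw [← hGn]
    refine lt_of_le_of_ne (Subgroup.card_le_card_group M) fun h => hHn ?_
    rw [← Subgroup.normalizer_eq_top_iff]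
    exact Subgroup.eq_top_of_card_eq M h
  set I : Finset (Subgroup G) :=
    Finset.univ.filter fun K : Subgroup G => IsPGroup p K ∧ H ≤ K ∧ K ≤ M with hI
  have hlt : ∀ Q : Sylow p G, H ≤ (Q : Subgroup G) → H < (Q : Subgroup G) ⊓ M := fun Q hQ =>
    pgroup_lt_normalizer Q.2 (lt_of_le_of_ne hQ fun h => hHs ⟨Q, h.symm⟩)
  -- Sylow sum for G
  have hA : ∑ K ∈ I, μ K * (Nat.card {Q : Sylow p G // K ≤ (Q : Subgroup G)} : ℤ) = 0 :=
    sum_card_swap I μ (fun (Q : Sylow p G) K => K ≤ (Q : Subgroup G)) fun Q =>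
      sum_filter_le H M μ hμ Q Q.2 (hlt Q) _ fun K _ => Iff.rfl
  -- Sylow sum for M
  have hB : ∑ K ∈ I, μ K *
      (Nat.card {Q : Sylow p M // K.subgroupOf M ≤ (Q : Subgroup M)} : ℤ) = 0 := by
    refine sum_card_swap I μ (fun (Q : Sylow p M) K => K.subgroupOf M ≤ (Q : Subgroup M)) fun Q =>
      sum_filter_le H M μ hμ ((Q : Subgroup M).map M.subtype) (Q.2.map _) (fun hHQ => ?_) _
        fun K hK => ?_
    · refine lt_of_le_of_ne (le_inf hHQ hHM) fun h => ?_
      obtain ⟨Q', hQ'⟩ := hH.exists_le_sylow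
      have h1 := hlt Q' hQ'
      have h2 : H = (Q : Subgroup M).map M.subtype := by
        rw [h]; exact inf_eq_left.2 (Subgroup.map_subtype_le _)
      have h3 : (Q : Subgroup M) ≤ (Q' : Subgroup G).subgroupOf M := by
        rw [Subgroup.subgroupOf, ← Subgroup.map_le_iff_le_comap, ← h2]
        exact hQ'
      have h4 := Q.3 Q'.2.comap_subtype h3
      rw [← h4] at h2
      exact h1.ne (h2.trans (Subgroup.subgroupOf_map_subtype _ _))
    · constructor
      · intro h
        have := Subgroup.map_mono (f := M.subtype) h
        rwa [Subgroup.map_subgroupOf_eq_of_le hK] at this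
      · intro h
        have := Subgroup.comap_mono (f := M.subtype) h
        rwa [Subgroup.comap_map_eq_self_of_injective M.subtype_injective] at this
  -- elements of M
  have hC : ∑ K ∈ I, μ K * (Nat.card {g : M // (g : G) ∈ subnSet p N K} : ℤ) = 0 := by
    have hpos : (Nat.card (Sylow p M) : ℤ) ≠ 0 := by
      exact_mod_cast Nat.card_pos.ne'
    refine (mul_eq_zero.1 ?_).resolve_right hpos
    have : ∀ K ∈ I, (Nat.card {g : M // (g : G) ∈ subnSet p N K} : ℤ) * Nat.card (Sylow p M) =
        Nat.card (N.subgroupOf M) *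
          Nat.card {Q : Sylow p M // K.subgroupOf M ≤ (Q : Subgroup M)} := by
      intro K hK
      simp only [hI, Finset.mem_filter, Finset.mem_univ, true_and] at hK
      have h1 := IH _ hMcard M rfl (N.subgroupOf M) inferInstance
        (fun g => by
          obtain ⟨k, hk⟩ := hN g
          exact ⟨k, by simpa [mem_subgroupOf] using hk⟩) (K.subgroupOf M) hK.1.comap_subtype
      have h2 : Nat.card (subnSet p (N.subgroupOf M) (K.subgroupOf M)) =
          Nat.card {g : M // (g : G) ∈ subnSet p N K} :=
        Nat.card_congr (Equiv.subtypeEquivRight fun g => mem_subnSet_subgroupOf M N K hK.2.2 g)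
      rw [h2] at h1
      exact_mod_cast h1
    rw [Finset.sum_mul]
    have h3 : ∀ K ∈ I, μ K * (Nat.card {g : M // (g : G) ∈ subnSet p N K} : ℤ) *
        Nat.card (Sylow p M) = Nat.card (N.subgroupOf M) * (μ K *
          (Nat.card {Q : Sylow p M // K.subgroupOf M ≤ (Q : Subgroup M)} : ℤ)) := by
      intro K hK
      rw [mul_assoc, this K hK]; ring
    rw [Finset.sum_congr rfl h3, ← Finset.mul_sum, hB, mul_zero]
  -- elements outside M
  have hD : ∑ K ∈ I, μ K * (Nat.card {g : {g : G // g ∉ M} // (g : G) ∈ subnSet p N K} : ℤ) = 0 := by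
    refine sum_card_swap I μ (fun (g : {g : G // g ∉ M}) K => (g : G) ∈ subnSet p N K) ?_
    rintro ⟨g, hg⟩
    by_cases hgH : g ∈ subnSet p N H
    · obtain ⟨hgN, V, hV, hHV, hgV⟩ := hgH
      set W : Subgroup G := sInf {V | H ≤ V ∧ g ∈ normalizer (V : Set G)} with hWdef
      have hHW : H ≤ W := le_sInf fun V hV => hV.1
      have hWle : ∀ V : Subgroup G, H ≤ V → g ∈ normalizer (V : Set G) → W ≤ V :=
        fun V h1 h2 => sInf_le ⟨h1, h2⟩
      have hW : IsPGroup p W := hV.to_le (hWle V hHV hgV)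
      have hgW : g ∈ normalizer (W : Set G) := by
        rw [mem_normalizer_iff]
        intro h
        simp only [hWdef, Subgroup.mem_sInf]
        exact forall₂_congr fun V hV => mem_normalizer_iff.1 hV.2 h
      have hHW' : H < W := lt_of_le_of_ne hHW fun h => hg (by rw [hM, h]; exact hgW)
      refine weisner H μ hμ (W ⊓ M) (pgroup_lt_normalizer hW hHW') _ ?_ ?_ ?_
      · intro K hK
        simp only [hI, Finset.mem_filter, Finset.mem_univ, true_and] at hK
        exact hK.1.2.1
      · intro K L hHK hKL hL
        simp only [hI, Finset.mem_filter, Finset.mem_univ, true_and] at hL ⊢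
        obtain ⟨⟨h1, h2, h3⟩, h4, V, h5, h6, h7⟩ := hL
        exact ⟨⟨h1.to_le hKL, hHK, hKL.trans h3⟩, h4, V, h5, hKL.trans h6, h7⟩
      · intro K hK
        simp only [hI, Finset.mem_filter, Finset.mem_univ, true_and] at hK ⊢
        obtain ⟨⟨h1, h2, h3⟩, h4, V, h5, h6, h7⟩ := hK
        have h8 : K ⊔ W ⊓ M ≤ V := sup_le h6 (inf_le_left.trans (hWle V (h2.trans h6) h7))
        exact ⟨⟨h5.to_le h8, h2.trans le_sup_left, sup_le h3 inf_le_right⟩, h4, V, h5, h8, h7⟩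
    · refine Finset.sum_eq_zero fun K hK => ?_
      simp only [hI, Finset.mem_filter, Finset.mem_univ, true_and] at hK
      obtain ⟨⟨h1, h2, h3⟩, h4, V, h5, h6, h7⟩ := hK
      exact absurd ⟨h4, V, h5, h2.trans h6, h7⟩ hgH
  have hE : ∑ K ∈ I, μ K * (Nat.card (subnSet p N K) : ℤ) = 0 := by
    rw [← add_zero (0 : ℤ)]
    nth_rewrite 1 [← hC]
    rw [← hD, ← Finset.sum_add_distrib]
    refine Finset.sum_congr rfl fun K _ => ?_
    rw [← mul_add]
    congr 1
    have e : subnSet p N K ≃ {g : M // (g : G) ∈ subnSet p N K} ⊕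
        {g : {g : G // g ∉ M} // (g : G) ∈ subnSet p N K} :=
      (Equiv.sumCompl (fun g : subnSet p N K => (g : G) ∈ M)).symm.trans
        (Equiv.sumCongr (Equiv.subtypeSubtypeEquivSubtypeInter _ _ |>.trans
            ((Equiv.subtypeEquivRight fun _ => and_comm).trans
              (Equiv.subtypeSubtypeEquivSubtypeInter _ _).symm))
          (Equiv.subtypeSubtypeEquivSubtypeInter (· ∈ subnSet p N K) (· ∉ M) |>.trans
            ((Equiv.subtypeEquivRight fun _ => and_comm).trans
              (Equiv.subtypeSubtypeEquivSubtypeInter (· ∉ M) (· ∈ subnSet p N K)).symm)))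
    rw [Nat.card_congr e, Nat.card_sum]
    push_cast; rfl
  have hHI : H ∈ I := by simp [hI, hH, hHM]
  have hF : ∑ K ∈ I, μ K * ((Nat.card (subnSet p N K) : ℤ) * Nat.card (Sylow p G) -
      Nat.card N * Nat.card {Q : Sylow p G // K ≤ (Q : Subgroup G)}) = 0 := by
    have : ∀ K ∈ I, μ K * ((Nat.card (subnSet p N K) : ℤ) * Nat.card (Sylow p G) -
      Nat.card N * Nat.card {Q : Sylow p G // K ≤ (Q : Subgroup G)}) =
      (μ K * (Nat.card (subnSet p N K) : ℤ)) * Nat.card (Sylow p G) -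
      Nat.card N * (μ K * (Nat.card {Q : Sylow p G // K ≤ (Q : Subgroup G)} : ℤ)) := by
      intro K _; ring
    rw [Finset.sum_congr rfl this, Finset.sum_sub_distrib, ← Finset.sum_mul, ← Finset.mul_sum,
      hA, hE]
    simp
  rw [Finset.sum_eq_single_of_mem H hHI, hμ1, one_mul, sub_eq_zero] at hF
  · exact_mod_cast hF
  · intro K hK hne
    simp only [hI, Finset.mem_filter, Finset.mem_univ, true_and] at hK
    have := ih K (lt_of_le_of_ne hK.2.1 (Ne.symm hne)) hK.1
    rw [mul_eq_zero, sub_eq_zero]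
    right
    exact_mod_cast this

theorem IsSubnormalIn.cons {G : Type*} [Group G] {H H' K : Subgroup G} (hle : H ≤ H')
    (hn : (H.subgroupOf H').Normal) (h : IsSubnormalIn H' K) : IsSubnormalIn H K := by
  obtain ⟨n, c, h0, h1, h2⟩ := h
  refine ⟨n + 1, Fin.cons H c, rfl, ?_, ?_⟩
  · rw [← Fin.succ_last, Fin.cons_succ, h1]
  · intro i
    refine Fin.cases ?_ (fun j => ?_) i
    · rw [Fin.castSucc_zero, Fin.cons_zero, Fin.cons_succ, h0]
      exact ⟨hle, hn⟩
    · rw [← Fin.succ_castSucc, Fin.cons_succ, Fin.cons_succ]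
      exact h2 j

theorem IsSubnormalIn.refl {G : Type*} [Group G] (H : Subgroup G) : IsSubnormalIn H H :=
  ⟨0, fun _ => H, rfl, rfl, fun i => i.elim0⟩

theorem isSubnormalIn_of_pgroup {p : ℕ} [Fact p.Prime] {G : Type*} [Group G] [Finite G]
    {V K : Subgroup G} (hV : IsPGroup p V) (hVK : V ≤ K) (hn : K ≤ normalizer (V : Set G))
    (H : Subgroup G) : H ≤ V → IsSubnormalIn H K := by
  induction H using WellFoundedGT.induction with
  | ind H ih =>
  intro hHV
  rcases hHV.eq_or_lt with rfl | hlt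
  · exact (IsSubnormalIn.refl K).cons hVK ((normal_subgroupOf_iff_le_normalizer hVK).2 hn)
  · have h1 := pgroup_lt_normalizer hV hlt
    exact (ih _ h1 inf_le_left).cons h1.le
      ((normal_subgroupOf_iff_le_normalizer h1.le).2 inf_le_right)

theorem exists_normal_pgroup_step {p : ℕ} {G : Type*} [Group G] [Finite G]
    {H C D : Subgroup G} (hCD : C ≤ D) (hn : (C.subgroupOf D).Normal)
    (h : ∃ V : Subgroup G, IsPGroup p V ∧ H ≤ V ∧ V ≤ C ∧ C ≤ normalizer (V : Set G)) :
    ∃ V : Subgroup G, IsPGroup p V ∧ H ≤ V ∧ V ≤ D ∧ D ≤ normalizer (V : Set G) := by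
  obtain ⟨V, hV, hmax⟩ := (Set.toFinite {V : Subgroup G | IsPGroup p V ∧ H ≤ V ∧ V ≤ C ∧
    C ≤ normalizer (V : Set G)}).exists_maximal h
  obtain ⟨h1, h2, h3, h4⟩ := hV
  have hnD : D ≤ normalizer (C : Set G) := (normal_subgroupOf_iff_le_normalizer hCD).1 hn
  have key : ∀ d ∈ D, V.map (MulAut.conj d).toMonoidHom ≤ V := by
    intro d hd
    set V' := V.map (MulAut.conj d).toMonoidHom with hV'
    have hdC := mem_normalizer_iff_map_conj_eq.1 (hnD hd)
    have a1 : IsPGroup p V' := h1.map _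
    have a3 : V' ≤ C := by
      have := Subgroup.map_mono (f := (MulAut.conj d).toMonoidHom) h3
      exact this.trans hdC.le
    have a4 : C ≤ normalizer (V' : Set G) := by
      intro c hc
      rw [mem_normalizer_iff]
      intro k
      have hc' : d⁻¹ * c * d ∈ C := (mem_normalizer_iff''.1 (hnD hd) c).1 hc
      have := mem_normalizer_iff.1 (h4 hc') (d⁻¹ * k * d)
      have hm : ∀ y, y ∈ V' ↔ d⁻¹ * y * d ∈ V := by
        intro y
        rw [hV', Subgroup.mem_map]
        constructor
        · rintro ⟨v, hv, rfl⟩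
          simpa [mul_assoc] using hv
        · intro h
          exact ⟨_, h, by simp [mul_assoc]⟩
      rw [hm, hm, this]
      simp [mul_assoc]
    have a5 : V ⊔ V' ≤ V := hmax
      ⟨h1.to_sup_of_normal_right' a1 (h3.trans a4), h2.trans le_sup_left, sup_le h3 a3, ?_⟩
      le_sup_left
    · exact le_sup_right.trans a5
    · intro c hc
      rw [mem_normalizer_iff_map_conj_eq, Subgroup.map_sup,
        mem_normalizer_iff_map_conj_eq.1 (h4 hc), mem_normalizer_iff_map_conj_eq.1 (a4 hc)]
  refine ⟨V, h1, h2, h3.trans hCD, fun d hd => ?_⟩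
  rw [mem_normalizer_iff]
  intro k
  constructor
  · intro hk
    exact key d hd ⟨k, hk, rfl⟩
  · intro hk
    have := key d⁻¹ (D.inv_mem hd) ⟨_, hk, rfl⟩
    simpa [mul_assoc] using this

theorem isSubnormalIn_iff {p : ℕ} [Fact p.Prime] {G : Type*} [Group G] [Finite G]
    {x : G} (hx : IsPGroup p (zpowers x)) (g : G) :
    IsSubnormalIn (zpowers x) (zpowers x ⊔ zpowers g) ↔
      ∃ V : Subgroup G, IsPGroup p V ∧ zpowers x ≤ V ∧ g ∈ normalizer (V : Set G) := by
  constructor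
  · rintro ⟨n, c, h0, h1, h2⟩
    have : ∀ i : Fin (n + 1), ∃ V : Subgroup G, IsPGroup p V ∧ zpowers x ≤ V ∧ V ≤ c i ∧
        c i ≤ normalizer (V : Set G) := by
      intro i
      induction i using Fin.induction with
      | zero => exact ⟨zpowers x, hx, le_rfl, h0.ge, h0.le.trans le_normalizer⟩
      | succ i ih => exact exists_normal_pgroup_step (h2 i).1 (h2 i).2 ih
    obtain ⟨V, a1, a2, a3, a4⟩ := this (Fin.last n)
    rw [h1] at a4
    exact ⟨V, a1, a2, a4 (mem_sup_right (mem_zpowers g))⟩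
  · rintro ⟨V, hV, hxV, hg⟩
    have hK : zpowers x ⊔ zpowers g ≤ normalizer (V : Set G) :=
      sup_le (hxV.trans le_normalizer) (zpowers_le.2 hg)
    refine isSubnormalIn_of_pgroup (p := p) (V := V ⊓ (zpowers x ⊔ zpowers g))
      (hV.to_le inf_le_left) inf_le_right ?_ _ (le_inf hxV le_sup_left)
    intro k hk
    rw [mem_normalizer_iff_map_conj_eq, Subgroup.map_inf _ _ _ (MulAut.conj k).injective,
      mem_normalizer_iff_map_conj_eq.1 (hK hk),
      mem_normalizer_iff_map_conj_eq.1 (le_normalizer hk)]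

/-- Lemma: if `N ⊴ G`, `P` is a Sylow `p`-subgroup of `G` and `x ∈ P`, then
`|N| · λ_{NP}(x) = |S_N(x)| · n_p(NP)`; in particular `λ_{NP}(x)` does not depend
on the choice of the Sylow `p`-subgroup `P` containing `x`. -/
theorem card_mul_lambda_sup_eq {G : Type*} [Group G] [Fintype G]
    (p : ℕ) (hp : p.Prime) (N : Subgroup G) (hN : N.Normal)
    (P : Sylow p G) (x : G) (hx : x ∈ P) :
    Nat.card N *
        Nat.card {Q : Sylow p ↥(N ⊔ (P : Subgroup G)) //
          (⟨x, Subgroup.mem_sup_right hx⟩ : ↥(N ⊔ (P : Subgroup G))) ∈ Q} =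
      Nat.card (subnormalizerSetIn N x) *
        Nat.card (Sylow p ↥(N ⊔ (P : Subgroup G))) := by
  haveI : Fact p.Prime := ⟨hp⟩
  set L : Subgroup G := N ⊔ (P : Subgroup G) with hL
  have hNL : N ≤ L := le_sup_left
  have hxL : x ∈ L := Subgroup.mem_sup_right hx
  have hxP : IsPGroup p (zpowers x) := P.2.to_le (zpowers_le.2 hx)
  have hxle : zpowers x ≤ L := zpowers_le.2 hxL
  have hpow : ∀ g : L, ∃ k : ℕ, g ^ p ^ k ∈ N.subgroupOf L := by
    rintro ⟨g, hg⟩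
    obtain ⟨n, hn, q, hq, rfl⟩ := mem_sup_of_normal_left.1 hg
    obtain ⟨k, hk⟩ := P.2 ⟨q, hq⟩
    refine ⟨k, ?_⟩
    have hk' : q ^ p ^ k = 1 := by simpa using congrArg Subtype.val hk
    rw [mem_subgroupOf]
    change (n * q) ^ p ^ k ∈ N
    rw [← QuotientGroup.eq_one_iff, QuotientGroup.mk_pow, QuotientGroup.mk_mul,
      (QuotientGroup.eq_one_iff n).2 hn, one_mul, ← QuotientGroup.mk_pow, hk',
      QuotientGroup.mk_one]
  have h := main_aux p _ L rfl (N.subgroupOf L) inferInstance hpow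
    ((zpowers x).subgroupOf L) hxP.comap_subtype
  have h1 : Nat.card (N.subgroupOf L) = Nat.card N :=
    Nat.card_congr (Subgroup.subgroupOfEquivOfLe hNL).toEquiv
  have h2 : Nat.card (subnSet p (N.subgroupOf L) ((zpowers x).subgroupOf L)) =
      Nat.card (subnormalizerSetIn N x) := by
    refine Nat.card_congr ⟨fun g => ⟨g.1.1, ?_⟩, fun g => ⟨⟨g.1, hNL g.2.1⟩, ?_⟩,
      fun _ => rfl, fun _ => rfl⟩
    · have := (mem_subnSet_subgroupOf L N (zpowers x) hxle g.1).1 g.2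
      exact ⟨this.1, (isSubnormalIn_iff hxP _).2 this.2⟩
    · exact (mem_subnSet_subgroupOf L N (zpowers x) hxle _).2
        ⟨g.2.1, (isSubnormalIn_iff hxP _).1 g.2.2⟩
  have h3 : Nat.card {Q : Sylow p L // (zpowers x).subgroupOf L ≤ (Q : Subgroup L)} =
      Nat.card {Q : Sylow p L // (⟨x, hxL⟩ : L) ∈ Q} := by
    refine Nat.card_congr (Equiv.subtypeEquivRight fun Q => ?_)
    constructor
    · intro hQ
      exact hQ (mem_subgroupOf.2 (mem_zpowers x))
    · rintro hQ ⟨y, hy⟩ hyx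
      obtain ⟨m, rfl⟩ := mem_zpowers_iff.1 (mem_subgroupOf.1 hyx)
      exact (Q : Subgroup L).zpow_mem hQ m
  rw [h1, h2, h3] at h
  exact h.symm
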